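/- arXiv:1705.00588 — 2 statements merged into one kernel-verified Lean document; each statement's English description precedes it below -/
import Mathlib

section
/- Let M be a free N-pseudospace and A a closed subset of M. Then every x ∈ M is contained in a closed subset B of M which is finitely constructible over A. -/
/-- A *zigzag* of length `n`: consecutive terms are strictly comparable and every
interior term is either the infimum (a sink) or the supremum (a peak) of its two
neighbours. -/
def IsZigzag {V : Type*} [Lattice V] (x : ℕ → V) (n : ℕ) : Prop :=
  (∀ i < n, x i < x (i + 1) ∨ x (i + 1) < x i) ∧
  ∀ i, i + 2 ≤ n →
    (x (i + 1) < x i ∧ x (i + 1) < x (i + 2) ∧ x (i + 1) = x i ⊓ x (i + 2)) ∨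
    (x i < x (i + 1) ∧ x (i + 2) < x (i + 1) ∧ x (i + 1) = x i ⊔ x (i + 2))

/-- A *zigzag cycle* of length `2 * n`: a `2 * n`-periodic sequence satisfying the
zigzag condition at every index (i.e. indices modulo `2 * n`). -/
def IsZigzagCycle {V : Type*} [Lattice V] (x : ℕ → V) (n : ℕ) : Prop :=
  0 < n ∧ (∀ i, x (i + 2 * n) = x i) ∧
  ∀ i,
    (x (i + 1) < x i ∧ x (i + 1) < x (i + 2) ∧ x (i + 1) = x i ⊓ x (i + 2)) ∨
    (x i < x (i + 1) ∧ x (i + 2) < x (i + 1) ∧ x (i + 1) = x i ⊔ x (i + 2))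

/-- A lattice is *simply connected* if it contains no zigzag cycles. -/
def SimplyConnected (V : Type*) [Lattice V] : Prop :=
  ∀ (x : ℕ → V) (n : ℕ), ¬IsZigzagCycle x n

/-- A *free N-pseudospace* structure on a bounded lattice `M`: an `N`-geometry
(layers indexed by `-1, …, N+1` via the function `layer`, strictly monotone,
with `⊥` in layer `-1` and `⊤` in layer `N+1`) which is simply connected and such
that for all `a < b` and every layer index `s` strictly between the layers of `a`
and `b` there are infinitely many `x` in layer `s` with `a < x < b`. -/
structure FreePseudospace (N : ℕ) (M : Type*) [Lattice M] [BoundedOrder M] where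
  layer : M → ℤ
  layer_bot : layer ⊥ = -1
  layer_top : layer ⊤ = (N : ℤ) + 1
  layer_bounds : ∀ v : M, -1 ≤ layer v ∧ layer v ≤ (N : ℤ) + 1
  layer_strictMono : ∀ v w : M, v < w → layer v < layer w
  simplyConnected : SimplyConnected M
  dense_layers : ∀ a b : M, a < b → ∀ s : ℤ, layer a < s → s < layer b →
    {x : M | a < x ∧ x < b ∧ layer x = s}.Infinite

/-- A subset `A` is *closed* if it contains `⊥` and `⊤` and every zigzag whose two
endpoints lie in `A` lies entirely in `A`. -/
def ZClosed {M : Type*} [Lattice M] [BoundedOrder M] (A : Set M) : Prop :=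
  ⊥ ∈ A ∧ ⊤ ∈ A ∧
  ∀ (x : ℕ → M) (n : ℕ), IsZigzag x n → x 0 ∈ A → x n ∈ A → ∀ i ≤ n, x i ∈ A

/-- A *direct path* from `x 0` to `A`: a zigzag `x 0, …, x n` with `x i ∉ A` for
`i < n`, `x n ∈ A`, and no element of `A` strictly between `x (n-1)` and `x n`. -/
def IsDirectPath {M : Type*} [Lattice M] (x : ℕ → M) (n : ℕ) (A : Set M) : Prop :=
  IsZigzag x n ∧ (∀ i < n, x i ∉ A) ∧ x n ∈ A ∧
  ∀ y ∈ A, ¬((x (n - 1) < y ∧ y < x n) ∨ (x n < y ∧ y < x (n - 1)))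

/-- `B` is *finitely constructible* over the closed set `A` if `B = A ∪ {v₁, …, vₖ}`
for a finite sequence `v₁, …, vₖ` such that every `Bᵢ = A ∪ {v₁, …, vᵢ}` is closed
and `vᵢ ∉ Bᵢ₋₁`. -/
def FinitelyConstructible {M : Type*} [Lattice M] [BoundedOrder M]
    (A B : Set M) : Prop :=
  ∃ l : List M,
    B = A ∪ {y | y ∈ l} ∧
    (∀ n : ℕ, ZClosed (A ∪ {y | y ∈ l.take n})) ∧
    ∀ (i : ℕ) (h : i < l.length), l.get ⟨i, h⟩ ∉ A ∪ {y | y ∈ l.take i}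

namespace IsZigzag

variable {V : Type*} [Lattice V]

theorem mono {x : ℕ → V} {n m : ℕ} (h : IsZigzag x n) (hm : m ≤ n) : IsZigzag x m :=
  ⟨fun i hi => h.1 i (by omega), fun i hi => h.2 i (by omega)⟩

theorem shift {x : ℕ → V} {n : ℕ} (k : ℕ) (h : IsZigzag x (n + k)) :
    IsZigzag (fun i => x (i + k)) n := by
  refine ⟨fun i hi => ?_, fun i hi => ?_⟩
  · have := h.1 (i + k) (by omega)
    rwa [show i + k + 1 = i + 1 + k by omega] at this
  · have := h.2 (i + k) (by omega)
    rwa [show i + k + 1 = i + 1 + k by omega, show i + k + 2 = i + 2 + k by omega] at this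

theorem reverse {x : ℕ → V} {n : ℕ} (h : IsZigzag x n) : IsZigzag (fun i => x (n - i)) n := by
  refine ⟨fun i hi => ?_, fun i hi => ?_⟩
  · have := h.1 (n - (i + 1)) (by omega)
    rw [show n - (i + 1) + 1 = n - i by omega] at this
    exact this.symm
  · have := h.2 (n - (i + 2)) (by omega)
    rw [show n - (i + 2) + 1 = n - (i + 1) by omega,
      show n - (i + 2) + 2 = n - i by omega] at this
    rcases this with ⟨h1, h2, h3⟩ | ⟨h1, h2, h3⟩
    · exact Or.inl ⟨h2, h1, by rw [inf_comm]; exact h3⟩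
    · exact Or.inr ⟨h2, h1, by rw [sup_comm]; exact h3⟩

theorem dual {x : ℕ → V} {n : ℕ} (h : IsZigzag x n) :
    IsZigzag (V := Vᵒᵈ) (fun i => OrderDual.toDual (x i)) n :=
  ⟨fun i hi => (h.1 i hi).symm, fun i hi => (h.2 i hi).symm⟩

/-- Prepending an element to a zigzag. -/
theorem cons {x : ℕ → V} {n : ℕ} (h : IsZigzag x n) {a : V} (ha : a < x 0 ∨ x 0 < a)
    (h0 : 1 ≤ n → (x 0 < a ∧ x 0 < x 1 ∧ x 0 = a ⊓ x 1) ∨ (a < x 0 ∧ x 1 < x 0 ∧ x 0 = a ⊔ x 1)) :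
    IsZigzag (fun i => Nat.casesOn i a x : ℕ → V) (n + 1) := by
  refine ⟨fun i hi => ?_, fun i hi => ?_⟩
  · cases i with
    | zero => exact ha
    | succ i => exact h.1 i (by omega)
  · cases i with
    | zero => exact h0 (by omega)
    | succ i => exact h.2 i (by omega)

theorem peak {x : ℕ → V} {n i : ℕ} (h : IsZigzag x n) (hi : i + 2 ≤ n) (hx : x i < x (i + 1)) :
    x (i + 2) < x (i + 1) ∧ x (i + 1) = x i ⊔ x (i + 2) := by
  rcases h.2 i hi with h1 | h1
  · exact absurd hx h1.1.asymm
  · exact h1.2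

theorem sink {x : ℕ → V} {n i : ℕ} (h : IsZigzag x n) (hi : i + 2 ≤ n) (hx : x (i + 1) < x i) :
    x (i + 1) < x (i + 2) ∧ x (i + 1) = x i ⊓ x (i + 2) := by
  rcases h.2 i hi with h1 | h1
  · exact h1.2
  · exact absurd hx h1.1.asymm

theorem parity {x : ℕ → V} {n : ℕ} (h : IsZigzag x n) (h0 : x 0 < x 1) :
    ∀ i < n, (i % 2 = 0 → x i < x (i + 1)) ∧ (i % 2 = 1 → x (i + 1) < x i) := by
  intro i
  induction i with
  | zero => exact fun _ => ⟨fun _ => h0, fun h => by omega⟩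
  | succ i ih =>
    intro hi
    obtain ⟨h1, h2⟩ := ih (by omega)
    exact ⟨fun hp => (h.sink (by omega) (h2 (by omega))).1,
      fun hp => (h.peak (by omega) (h1 (by omega))).1⟩

end IsZigzag

theorem SimplyConnected.dual {V : Type*} [Lattice V] (h : SimplyConnected V) :
    SimplyConnected Vᵒᵈ := fun x n hx =>
  h (fun i => OrderDual.ofDual (x i)) n ⟨hx.1, hx.2.1, fun i => (hx.2.2 i).symm⟩

/-- A zigzag returning to its starting point can be closed up to a zigzag cycle as soon as its
first and last interior elements are incomparable. -/
theorem IsZigzag.exists_cycle {V : Type*} [Lattice V] {y : ℕ → V} {k : ℕ} (hk : 2 ≤ k)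
    (hy : IsZigzag y (2 * k)) (h0 : y 0 < y 1) (hl : y (2 * k) = y 0)
    (h1 : ¬ y 1 ≤ y (2 * k - 1)) (h2 : ¬ y (2 * k - 1) ≤ y 1) :
    ∃ x : ℕ → V, IsZigzagCycle x k := by
  obtain ⟨m, rfl⟩ : ∃ m, k = m + 2 := ⟨k - 2, by omega⟩
  set w := y 1 ⊓ y (2 * (m + 2) - 1)
  have w1 : w < y 1 := inf_lt_left.2 h1
  have w2 : w < y (2 * (m + 2) - 1) := inf_lt_right.2 h2
  have hlast : y (2 * (m + 2)) < y (2 * (m + 2) - 1) := by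
    have := (hy.parity h0 (2 * (m + 2) - 1) (by omega)).2 (by omega)
    rwa [show 2 * (m + 2) - 1 + 1 = 2 * (m + 2) by omega] at this
  have w0 : y 0 ≤ w := le_inf h0.le (hl ▸ hlast.le)
  have hp1 := hy.peak (i := 0) (by omega) h0
  have hp2 := hy.reverse.peak (i := 0) (by omega) (by simpa using hlast)
  simp only [zero_add, tsub_zero] at hp1 hp2
  refine ⟨fun i => if i % (2 * (m + 2)) = 0 then w else y (i % (2 * (m + 2))), by omega,
    fun i => by simp, fun i => ?_⟩
  have hr : i % (2 * (m + 2)) < 2 * (m + 2) := Nat.mod_lt _ (by omega)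
  have e1 : (i + 1) % (2 * (m + 2)) = (i % (2 * (m + 2)) + 1) % (2 * (m + 2)) := by simp
  have e2 : (i + 2) % (2 * (m + 2)) = (i % (2 * (m + 2)) + 2) % (2 * (m + 2)) := by simp
  simp only [e1, e2]
  generalize i % (2 * (m + 2)) = r at hr
  rcases lt_or_ge (r + 2) (2 * (m + 2)) with h | h
  · rw [Nat.mod_eq_of_lt h, Nat.mod_eq_of_lt (show r + 1 < 2 * (m + 2) by omega)]
    rcases Nat.eq_zero_or_pos r with rfl | hr0
    · simp only [zero_add, if_true, one_ne_zero, if_false, OfNat.ofNat_ne_zero]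
      refine Or.inr ⟨w1, hp1.1, le_antisymm ?_ (sup_le w1.le hp1.1.le)⟩
      exact hp1.2.le.trans (sup_le_sup_right w0 _)
    · rw [if_neg (by omega), if_neg (by omega), if_neg (by omega)]
      exact hy.2 r (by omega)
  · obtain rfl | rfl : r = 2 * (m + 2) - 2 ∨ r = 2 * (m + 2) - 1 := by omega
    · rw [show 2 * (m + 2) - 2 + 2 = 2 * (m + 2) by omega, Nat.mod_self,
        show 2 * (m + 2) - 2 + 1 = 2 * (m + 2) - 1 by omega,
        Nat.mod_eq_of_lt (show 2 * (m + 2) - 1 < 2 * (m + 2) by omega), if_pos rfl,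
        if_neg (by omega), if_neg (by omega)]
      refine Or.inr ⟨hp2.1, w2, le_antisymm ?_ (sup_le hp2.1.le w2.le)⟩
      refine hp2.2.le.trans ?_
      rw [sup_comm, hl]
      exact sup_le_sup_left w0 _
    · rw [show 2 * (m + 2) - 1 + 2 = 1 + 2 * (m + 2) by omega, Nat.add_mod_right,
        show 2 * (m + 2) - 1 + 1 = 2 * (m + 2) by omega, Nat.mod_self,
        Nat.mod_eq_of_lt (show 1 < 2 * (m + 2) by omega), if_pos rfl,
        if_neg (by omega), if_neg (by omega)]
      exact Or.inl ⟨w2, w1, by rw [inf_comm]⟩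

/-- In a simply connected lattice a zigzag that starts upwards never ends at or below its
starting point. -/
theorem IsZigzag.not_le_of_simplyConnected (m : ℕ) : ∀ {V : Type*} [Lattice V],
    SimplyConnected V → ∀ y : ℕ → V, IsZigzag y m → 1 ≤ m → y 0 < y 1 → ¬ y m ≤ y 0 := by
  induction m using Nat.strong_induction_on with
  | _ m ih =>
  intro V _ hV y hy hm h0 hle
  obtain rfl | hm2 : m = 1 ∨ 2 ≤ m := by omega
  · exact absurd h0 hle.not_gt
  obtain rfl | hm3 : m = 2 ∨ 3 ≤ m := by omega
  · have hp := hy.peak (i := 0) (by omega) h0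
    simp only [zero_add] at hp
    rw [sup_eq_left.2 hle] at hp
    exact h0.ne' hp.2
  obtain ⟨k, rfl⟩ : ∃ k, m = k + 3 := ⟨m - 3, by omega⟩
  have last_lt : ∀ z : ℕ → V, IsZigzag z (k + 3) → z 0 < z 1 → z (k + 3) ≤ z 0 →
      z (k + 3) < z (k + 2) := fun z hz hz0 hzl => by
    refine (hz.1 (k + 2) (by omega)).resolve_left fun h => ?_
    exact ih (k + 2) (by omega) hV z (hz.mono (by omega)) (by omega) hz0 (h.le.trans hzl)
  have no_loop : ∀ z : ℕ → V, IsZigzag z (k + 3) → z 0 < z 1 → z (k + 3) ≠ z 0 := by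
    intro z hz hz0 heq
    have ihd : ∀ u : ℕ → V, IsZigzag u (k + 1) → u 1 < u 0 → ¬ u 0 ≤ u (k + 1) :=
      fun u hu hu0 => ih (k + 1) (by omega) hV.dual _ hu.dual (by omega) hu0
    have hp := hz.peak (i := 0) (by omega) hz0
    have hlast := last_lt z hz hz0 heq.le
    obtain ⟨j, hj⟩ : ∃ j, k + 3 = 2 * j := by
      have hodd : ¬ (k + 2) % 2 = 0 := fun h =>
        ((hz.parity hz0 (k + 2) (by omega)).1 h).asymm hlast
      exact ⟨(k + 3) / 2, by omega⟩
    by_cases c1 : z 1 ≤ z (k + 2)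
    · exact ihd _ ((hz.shift (n := k + 2) 1).mono (by omega)) hp.1 c1
    by_cases c2 : z (k + 2) ≤ z 1
    · refine ihd _ ((hz.mono (show k + 2 ≤ k + 3 by omega)).reverse.mono (by omega)) ?_ ?_
      · have hp2 := hz.reverse.peak (i := 0) (by omega) (by simpa using hlast)
        simpa using hp2.1
      · simpa [show k + 2 - (k + 1) = 1 by omega] using c2
    rw [hj] at hz heq
    rw [show k + 2 = 2 * j - 1 by omega] at c1 c2
    obtain ⟨x, hx⟩ := hz.exists_cycle (by omega) hz0 heq c1 c2
    exact hV x j hx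
  rcases hle.lt_or_eq with hlt | heq
  · have hp := hy.peak (i := 0) (by omega) h0
    have hs := hy.sink (i := 1) (by omega) hp.1
    simp only [zero_add, Nat.reduceAdd] at hp hs
    have c1 : ¬ y 2 ≤ y (k + 3) := fun h => by
      refine ih (k + 1) (by omega) hV _ ((hy.reverse).mono (by omega)) (by omega) ?_ ?_
      · simpa using last_lt y hy h0 hle
      · simpa [show k + 3 - (k + 1) = 2 by omega] using h
    have c2 : ¬ y (k + 3) ≤ y 2 := fun h =>
      ih (k + 1) (by omega) hV _ (hy.shift (n := k + 1) 2) (by omega) hs.1 h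
    have hw1 : y 2 < y (k + 3) ⊔ y 2 := right_lt_sup.2 c2
    have hw2 : y (k + 3) < y (k + 3) ⊔ y 2 := left_lt_sup.2 c1
    have hw3 : y (k + 3) ⊔ y 2 ≤ y 1 := sup_le (hlt.trans h0).le hp.1.le
    have hz := (hy.shift (n := k + 1) 2).cons (a := y (k + 3) ⊔ y 2) (Or.inr hw1)
      fun _ => Or.inl ⟨hw1, hs.1, le_antisymm (le_inf hw1.le hs.1.le)
        ((inf_le_inf_right _ hw3).trans hs.2.ge)⟩
    exact no_loop _ (hz.cons (a := y (k + 3)) (Or.inl hw2) fun _ => Or.inr ⟨hw2, hw1, rfl⟩)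
      hw2 rfl
  · exact no_loop y hy h0 heq

theorem IsZigzag.eq_zero_of_loop {V : Type*} [Lattice V] (hV : SimplyConnected V) {y : ℕ → V}
    {m : ℕ} (hy : IsZigzag y m) (h : y m = y 0) : m = 0 := by
  by_contra hm
  rcases hy.1 0 (by omega) with h0 | h0
  · exact IsZigzag.not_le_of_simplyConnected m hV y hy (by omega) h0 h.le
  · exact IsZigzag.not_le_of_simplyConnected m hV.dual _ hy.dual (by omega) h0 h.ge

namespace ZClosed

variable {M : Type*} [Lattice M] [BoundedOrder M]

theorem dual {A : Set M} (hA : ZClosed A) : ZClosed (M := Mᵒᵈ) (OrderDual.ofDual ⁻¹' A) :=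
  ⟨hA.2.1, hA.1, fun x n hx => hA.2.2 (fun i => OrderDual.ofDual (x i)) n hx.dual⟩

theorem sup_mem {A : Set M} (hA : ZClosed A) {a b : M} (ha : a ∈ A) (hb : b ∈ A) :
    a ⊔ b ∈ A := by
  by_cases h1 : a ≤ b
  · rwa [sup_eq_right.2 h1]
  by_cases h2 : b ≤ a
  · rwa [sup_eq_left.2 h2]
  have h : IsZigzag (fun i => Nat.casesOn i a fun i => Nat.casesOn i (a ⊔ b) fun _ => b : ℕ → M)
      2 := by
    have h3 : a < a ⊔ b := left_lt_sup.2 h2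
    have h4 : b < a ⊔ b := right_lt_sup.2 h1
    have h5 : IsZigzag (fun _ => b : ℕ → M) 0 := ⟨fun i hi => by omega, fun i hi => by omega⟩
    exact (h5.cons (a := a ⊔ b) (Or.inr h4) fun h => by omega).cons (Or.inl h3)
      fun _ => Or.inr ⟨h3, h4, rfl⟩
  exact hA.2.2 _ 2 h ha hb 1 (by omega)

theorem inf_mem {A : Set M} (hA : ZClosed A) {a b : M} (ha : a ∈ A) (hb : b ∈ A) :
    a ⊓ b ∈ A := hA.dual.sup_mem ha hb

/-- If a zigzag into a closed set `A` starts upwards and leaves its starting point outside `A`,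
then its second element lies below every upper bound in `A` of its starting point. -/
theorem lt_of_zigzag {A : Set M} (hA : ZClosed A) {z : ℕ → M} {n : ℕ} (hz : IsZigzag z n)
    (hn : 2 ≤ n) (hzn : z n ∈ A) (h0 : z 0 < z 1) (h1 : z 1 ∉ A) {b : M} (hb : b ∈ A)
    (hzb : z 0 ≤ b) : z 1 < b := by
  obtain ⟨k, rfl⟩ : ∃ k, n = k + 2 := ⟨n - 2, by omega⟩
  have hp := hz.peak (i := 0) (by omega) h0
  simp only [zero_add] at hp
  have key : ∀ c : M, z 0 ≤ c → c < z 1 →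
      (z 1 = c ⊔ z 2) := fun c hc hc1 =>
    le_antisymm (hp.2.le.trans (sup_le_sup_right hc _)) (sup_le hc1.le hp.1.le)
  have hs := hz.shift (n := k + 1) 1
  by_contra hlt
  by_cases hb1 : b ≤ z 1
  · have hb2 : b < z 1 := lt_of_le_of_ne hb1 fun h => h1 (h ▸ hb)
    exact h1 (hA.2.2 _ _ (hs.cons (Or.inl hb2) fun _ => Or.inr ⟨hb2, hp.1, key b hzb hb2⟩)
      hb hzn 1 (by omega))
  · have hb2 : ¬ z 1 ≤ b := fun h => hlt (lt_of_le_of_ne h fun h' => h1 (h' ▸ hb))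
    have h3 : b ⊓ z 1 < z 1 := inf_lt_right.2 hb2
    have h4 : b ⊓ z 1 < b := inf_lt_left.2 hb1
    have hz' := hs.cons (a := b ⊓ z 1) (Or.inl h3)
      fun _ => Or.inr ⟨h3, hp.1, key _ (le_inf hzb h0.le) h3⟩
    exact h1 (hA.2.2 _ _ (hz'.cons (a := b) (Or.inr h4) fun _ => Or.inl ⟨h4, h3, rfl⟩)
      hb hzn 2 (by omega))

/-- A closed set remains closed when one adds a point from which no zigzag reaches the set
through a further outside point. -/
theorem union_singleton (hM : SimplyConnected M) {A : Set M} (hA : ZClosed A) {x : M}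
    (hx : ∀ (z : ℕ → M) (n : ℕ), IsZigzag z n → z 0 = x → z n ∈ A → z 1 ∈ A) :
    ZClosed (A ∪ {x}) := by
  have key : ∀ (z : ℕ → M) (n : ℕ), IsZigzag z n → z 0 = x → z n ∈ A →
      ∀ i ≤ n, z i ∈ A ∪ {x} := by
    intro z n hz h0 hn i hi
    obtain rfl | ⟨i, rfl⟩ : i = 0 ∨ ∃ j, i = j + 1 := by cases i <;> simp
    · exact Or.inr h0
    obtain ⟨n, rfl⟩ : ∃ m, n = m + 1 := ⟨n - 1, by omega⟩
    exact Or.inl (hA.2.2 _ n (hz.shift 1) (hx z _ hz h0 hn) hn i (by omega))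
  refine ⟨Or.inl hA.1, Or.inl hA.2.1, fun z n hz h0 hn i hi => ?_⟩
  rcases h0 with h0 | h0 <;> rcases hn with hn | hn
  · exact Or.inl (hA.2.2 z n hz h0 hn i hi)
  · have := key _ n hz.reverse (by simpa using hn) (by simpa using h0) (n - i) (by omega)
    simpa only [show n - (n - i) = i by omega] using this
  · exact key z n hz h0 hn i hi
  · have := hz.eq_zero_of_loop hM (hn.trans h0.symm)
    rw [show i = 0 by omega]
    exact Or.inr h0

end ZClosed

namespace FinitelyConstructible

variable {M : Type*} [Lattice M] [BoundedOrder M]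

theorem refl {A : Set M} (hA : ZClosed A) : FinitelyConstructible A A :=
  ⟨[], by simp, by simpa using hA, by simp⟩

theorem zClosed {A B : Set M} (h : FinitelyConstructible A B) : ZClosed B := by
  obtain ⟨l, rfl, hl, -⟩ := h
  simpa using hl l.length

theorem union_singleton {A B : Set M} (h : FinitelyConstructible A B) {v : M} (hv : v ∉ B)
    (hB : ZClosed (B ∪ {v})) : FinitelyConstructible A (B ∪ {v}) := by
  obtain ⟨l, rfl, hl, hl'⟩ := h
  have hu : A ∪ {y | y ∈ l} ∪ {v} = A ∪ {y | y ∈ l ++ [v]} := by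
    ext y
    simp [or_comm, or_assoc]
  refine ⟨l ++ [v], hu, fun n => ?_, fun i hi => ?_⟩
  · rcases le_or_gt n l.length with h | h
    · rw [List.take_append_of_le_length h]
      exact hl n
    · rw [List.take_of_length_le (by simpa using h), ← hu]
      exact hB
  · rcases lt_or_ge i l.length with h | h
    · rw [List.take_append_of_le_length h.le]
      simpa [List.getElem_append_left h] using hl' i h
    · obtain rfl : i = l.length := by simp at hi; omega
      simpa using hv

end FinitelyConstructible

/-- A point between two elements of a set finitely constructible over `A` lies in a set finitely
constructible over `A`; the induction is on the difference of the layers of the bounds. -/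
theorem FreePseudospace.exists_finitelyConstructible_of_le_of_le {N : ℕ} {M : Type*} [Lattice M]
    [BoundedOrder M] (P : FreePseudospace N M) {A : Set M} (m : ℕ) :
    ∀ (B : Set M) (x a b : M), FinitelyConstructible A B → a ∈ B → b ∈ B → a ≤ x → x ≤ b →
      P.layer b - P.layer a ≤ m → ∃ C : Set M, x ∈ C ∧ B ⊆ C ∧ FinitelyConstructible A C := by
  induction m with
  | zero =>
    intro B x a b hB ha hb hax hxb hm
    refine ⟨B, ?_, subset_rfl, hB⟩
    rcases (hax.trans hxb).lt_or_eq with h | rfl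
    · have := P.layer_strictMono a b h
      omega
    · rwa [le_antisymm hxb hax]
  | succ m ih =>
    have between : ∀ (B : Set M) (z : ℕ → M) (n : ℕ) (a b : M), FinitelyConstructible A B →
        a ∈ B → b ∈ B → a ≤ z 0 → z 0 ≤ b → IsZigzag z (n + 2) → z (n + 2) ∈ B → z 1 ∉ B →
        (z 0 < z 1 ∧ z 1 < b) ∨ (a < z 1 ∧ z 1 < z 0) := by
      intro B z n a b hB ha hb haz hzb hz hzn h1
      rcases hz.1 0 (by omega) with h | h
      · exact Or.inl ⟨h, hB.zClosed.lt_of_zigzag hz (by omega) hzn h h1 hb hzb⟩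
      · exact Or.inr ⟨hB.zClosed.dual.lt_of_zigzag hz.dual (by omega) hzn h h1 ha haz, h⟩
    have next : ∀ (B : Set M) (z : ℕ → M) (n : ℕ) (a b : M), FinitelyConstructible A B →
        a ∈ B → b ∈ B → a ≤ z 0 → z 0 ≤ b → P.layer b - P.layer a ≤ (m + 1 : ℕ) →
        IsZigzag z (n + 2) → z (n + 2) ∈ B → z 2 ∈ B → z 1 ∉ B →
        ∃ C : Set M, z 1 ∈ C ∧ B ⊆ C ∧ FinitelyConstructible A C := by
      intro B z n a b hB ha hb haz hzb hm hz hzn h2 h1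
      rcases between B z n a b hB ha hb haz hzb hz hzn h1 with ⟨h3, h4⟩ | ⟨h3, h4⟩
      · have hp := hz.peak (i := 0) (by omega) h3
        have hlt : a < a ⊔ z 2 := left_lt_sup.2 fun h =>
          h3.ne' (hp.2.trans (sup_eq_left.2 (h.trans haz)))
        have := P.layer_strictMono _ _ hlt
        exact ih B (z 1) (a ⊔ z 2) b hB (hB.zClosed.sup_mem ha h2) hb
          (sup_le (haz.trans h3.le) hp.1.le) h4.le (by omega)
      · have hp := hz.sink (i := 0) (by omega) h4
        have hlt : b ⊓ z 2 < b := inf_lt_left.2 fun h =>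
          h4.ne (hp.2.trans (inf_eq_left.2 (hzb.trans h)))
        have := P.layer_strictMono _ _ hlt
        exact ih B (z 1) a (b ⊓ z 2) hB ha (hB.zClosed.inf_mem hb h2) h3.le
          (le_inf (h4.le.trans hzb) hp.1.le) (by omega)
    have finish : ∀ (B : Set M) (z : ℕ → M) (n : ℕ) (a b : M), FinitelyConstructible A B →
        a ∈ B → b ∈ B → a ≤ z 0 → z 0 ≤ b → P.layer b - P.layer a ≤ (m + 1 : ℕ) →
        IsZigzag z (n + 2) → z (n + 2) ∈ B → z 1 ∉ B →
        (∃ C : Set M, z 1 ∈ C ∧ B ⊆ C ∧ FinitelyConstructible A C) →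
        ∃ C : Set M, z 0 ∈ C ∧ B ⊆ C ∧ FinitelyConstructible A C := by
      rintro B z n a b hB ha hb haz hzb hm hz hzn h1 ⟨C, hC1, hBC, hC⟩
      rcases between B z n a b hB ha hb haz hzb hz hzn h1 with ⟨h3, h4⟩ | ⟨h3, h4⟩
      · have := P.layer_strictMono _ _ h4
        obtain ⟨D, hD, hCD, hAD⟩ := ih C (z 0) a (z 1) hC (hBC ha) hC1 haz h3.le (by omega)
        exact ⟨D, hD, hBC.trans hCD, hAD⟩
      · have := P.layer_strictMono _ _ h3
        obtain ⟨D, hD, hCD, hAD⟩ := ih C (z 0) (z 1) b hC hC1 (hBC hb) h4.le hzb (by omega)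
        exact ⟨D, hD, hBC.trans hCD, hAD⟩
    have path : ∀ n : ℕ, ∀ (B : Set M) (z : ℕ → M) (a b : M), FinitelyConstructible A B →
        a ∈ B → b ∈ B → a ≤ z 0 → z 0 ≤ b → P.layer b - P.layer a ≤ (m + 1 : ℕ) →
        IsZigzag z (n + 2) → z (n + 2) ∈ B → z 1 ∉ B →
        ∃ C : Set M, z 0 ∈ C ∧ B ⊆ C ∧ FinitelyConstructible A C := by
      intro n
      induction n with
      | zero =>
        intro B z a b hB ha hb haz hzb hm hz hzn h1
        exact finish B z 0 a b hB ha hb haz hzb hm hz hzn h1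
          (next B z 0 a b hB ha hb haz hzb hm hz hzn hzn h1)
      | succ n ihn =>
        intro B z a b hB ha hb haz hzb hm hz hzn h1
        refine finish B z _ a b hB ha hb haz hzb hm hz hzn h1 ?_
        by_cases h2 : z 2 ∈ B
        · exact next B z _ a b hB ha hb haz hzb hm hz hzn h2 h1
        · refine ihn B _ a b hB ha hb ?_ ?_ hm (hz.shift (n := n + 2) 1) hzn h2
          · rcases between B z _ a b hB ha hb haz hzb hz hzn h1 with ⟨h3, h4⟩ | ⟨h3, h4⟩
            exacts [haz.trans h3.le, h3.le]
          · rcases between B z _ a b hB ha hb haz hzb hz hzn h1 with ⟨h3, h4⟩ | ⟨h3, h4⟩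
            exacts [h4.le, h4.le.trans hzb]
    intro B x a b hB ha hb hax hxb hm
    by_cases hx : x ∈ B
    · exact ⟨B, hx, subset_rfl, hB⟩
    by_cases h : ∀ (z : ℕ → M) (n : ℕ), IsZigzag z n → z 0 = x → z n ∈ B → z 1 ∈ B
    · exact ⟨B ∪ {x}, Or.inr rfl, Set.subset_union_left,
        hB.union_singleton hx (hB.zClosed.union_singleton P.simplyConnected h)⟩
    · push Not at h
      obtain ⟨z, n, hz, rfl, hn, h1⟩ := h
      obtain rfl | rfl | ⟨n, rfl⟩ : n = 0 ∨ n = 1 ∨ ∃ k, n = k + 2 := by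
        rcases n with _ | _ | n <;> simp
      · exact absurd hn hx
      · exact absurd hn h1
      · exact path n B z a b hB ha hb hax hxb hm hz hn h1

/-- (Proposition 3.14) Every element of a free `N`-pseudospace is contained in a
finitely constructible extension of a given closed set `A`. -/
theorem exists_finitely_constructible {N : ℕ} {M : Type*}
    [Lattice M] [BoundedOrder M] (P : FreePseudospace N M)
    (A : Set M) (hA : ZClosed A) (x : M) :
    ∃ B : Set M, x ∈ B ∧ ZClosed B ∧ FinitelyConstructible A B := by
  obtain ⟨B, hx, -, hB⟩ := P.exists_finitelyConstructible_of_le_of_le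
    (P.layer ⊤ - P.layer ⊥).toNat A x ⊥ ⊤ (.refl hA) hA.1 hA.2.1 bot_le le_top
    (Int.self_le_toNat _)
  exact ⟨B, hx, hB.zClosed, hB⟩
end

section
/- In a free N-pseudospace M, the closure cl(X) of a set X ⊆ M consists of 0, 1 and all elements lying on zigzags between elements of X; that is, cl(X) = {0,1} ∪ {y ∈ M : y is a term of some zigzag whose two endpoints belong to X}. -/
/-- The *closure* `zcl X`: the smallest closed subset containing `X`. -/
def zcl {M : Type*} [Lattice M] [BoundedOrder M] (X : Set M) : Set M :=
  ⋂₀ {A : Set M | ZClosed A ∧ X ⊆ A}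

namespace ZigzagClosure

section Corner

variable {V : Type*} [Lattice V]

/-- The local zigzag condition: `b` is a sink or a peak between `a` and `c`. -/
def Corner (a b c : V) : Prop :=
  (b < a ∧ b < c ∧ b = a ⊓ c) ∨ (a < b ∧ c < b ∧ b = a ⊔ c)

theorem Corner.symm {a b c : V} (h : Corner a b c) : Corner c b a := by
  rcases h with ⟨h1, h2, h3⟩ | ⟨h1, h2, h3⟩
  · exact Or.inl ⟨h2, h1, by rw [inf_comm]; exact h3⟩
  · exact Or.inr ⟨h2, h1, by rw [sup_comm]; exact h3⟩

theorem Corner.of_lt {a b c : V} (h : Corner a b c) (hab : a < b) : c < b ∧ b = a ⊔ c := by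
  rcases h with ⟨h1, _, _⟩ | ⟨_, h2, h3⟩
  · exact absurd hab h1.asymm
  · exact ⟨h2, h3⟩

theorem Corner.of_gt {a b c : V} (h : Corner a b c) (hab : b < a) : b < c ∧ b = a ⊓ c := by
  rcases h with ⟨_, h2, h3⟩ | ⟨h1, _, _⟩
  · exact ⟨h2, h3⟩
  · exact absurd hab h1.asymm

theorem Corner.not_le {a b c : V} (h : Corner a b c) : ¬ a ≤ c := by
  intro hac
  rcases h with ⟨h1, _, h3⟩ | ⟨_, h2, h3⟩
  · rw [inf_eq_left.2 hac] at h3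
    exact h1.ne h3
  · rw [sup_eq_right.2 hac] at h3
    exact h2.ne' h3

/-- A peak may have one of its neighbours enlarged, as long as it stays below the peak. -/
theorem Corner.peak_mono {a a' b c : V} (h : Corner a b c) (hab : a < b) (haa' : a ≤ a')
    (ha'b : a' < b) : Corner a' b c := by
  obtain ⟨h2, h3⟩ := h.of_lt hab
  refine Or.inr ⟨ha'b, h2, le_antisymm ?_ (sup_le ha'b.le h2.le)⟩
  calc b = a ⊔ c := h3
    _ ≤ a' ⊔ c := sup_le_sup_right haa' c

/-- A sink may have one of its neighbours lowered, as long as it stays above the sink. -/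
theorem Corner.sink_mono {a a' b c : V} (h : Corner a b c) (hab : b < a) (haa' : a' ≤ a)
    (ha'b : b < a') : Corner a' b c := by
  obtain ⟨h2, h3⟩ := h.of_gt hab
  refine Or.inl ⟨ha'b, h2, le_antisymm (le_inf ha'b.le h2.le) ?_⟩
  calc a' ⊓ c ≤ a ⊓ c := inf_le_inf_right c haa'
    _ = b := h3.symm

theorem corner_dual {a b c : V} :
    Corner (V := Vᵒᵈ) (OrderDual.toDual a) (OrderDual.toDual b) (OrderDual.toDual c) ↔
      Corner a b c :=
  Or.comm

end Corner

section TermList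

variable {V : Type*}

/-- The list of the terms `x 0, …, x n`. -/
def termList (x : ℕ → V) : ℕ → List V
  | 0 => [x 0]
  | n + 1 => x 0 :: termList (fun i => x (i + 1)) n

theorem mem_termList {y : V} : ∀ {n : ℕ} {x : ℕ → V}, y ∈ termList x n ↔ ∃ i ≤ n, x i = y
  | 0, x => by simp [termList, eq_comm]
  | n + 1, x => by
    rw [termList, List.mem_cons, mem_termList]
    constructor
    · rintro (rfl | ⟨i, hi, rfl⟩)
      · exact ⟨0, by omega, rfl⟩
      · exact ⟨i + 1, by omega, rfl⟩
    · rintro ⟨i, hi, rfl⟩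
      cases i with
      | zero => exact Or.inl rfl
      | succ i => exact Or.inr ⟨i, by omega, rfl⟩

theorem head?_termList (x : ℕ → V) (n : ℕ) : (termList x n).head? = some (x 0) := by
  cases n <;> rfl

theorem getLast?_termList : ∀ (n : ℕ) (x : ℕ → V), (termList x n).getLast? = some (x n)
  | 0, _ => rfl
  | n + 1, x => by
    have ih := getLast?_termList n (fun i => x (i + 1))
    rw [termList, List.getLast?_cons, ih]
    rfl

end TermList

section Functions

variable {V : Type*} [Lattice V]

theorem isZigzag_shift {x : ℕ → V} {n : ℕ} (h : IsZigzag x (n + 1)) :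
    IsZigzag (fun i => x (i + 1)) n :=
  ⟨fun i hi => h.1 (i + 1) (by omega), fun i hi => h.2 (i + 1) (by omega)⟩

theorem isZigzag_take {x : ℕ → V} {n m : ℕ} (h : IsZigzag x n) (hm : m ≤ n) : IsZigzag x m :=
  ⟨fun i hi => h.1 i (by omega), fun i hi => h.2 i (by omega)⟩

theorem isZigzag_reverse {x : ℕ → V} {n : ℕ} (h : IsZigzag x n) :
    IsZigzag (fun i => x (n - i)) n := by
  refine ⟨fun i hi => ?_, fun i hi => ?_⟩
  · have := h.1 (n - (i + 1)) (by omega)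
    rw [show n - (i + 1) + 1 = n - i by omega] at this
    exact this.symm
  · have : Corner _ _ _ := h.2 (n - (i + 2)) (by omega)
    rw [show n - (i + 2) + 1 = n - (i + 1) by omega,
      show n - (i + 2) + 2 = n - i by omega] at this
    exact this.symm

theorem isZigzag_alternates {x : ℕ → V} {n : ℕ} (h : IsZigzag x n) (h0 : x 0 < x 1) :
    ∀ i < n, (Even i → x i < x (i + 1)) ∧ (¬ Even i → x (i + 1) < x i) := by
  intro i
  induction i with
  | zero => intro _; exact ⟨fun _ => h0, fun h => absurd Even.zero h⟩
  | succ i ih =>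
    intro hi
    have hc : Corner _ _ _ := h.2 i (by omega)
    obtain ⟨h1, h2⟩ := ih (by omega)
    rw [Nat.even_add_one]
    exact ⟨fun he => (hc.of_gt (h2 he)).1, fun he => (hc.of_lt (h1 (not_not.1 he))).1⟩

theorem isZigzagCycle_mod {y : ℕ → V} {k : ℕ} (hk : 2 ≤ k)
    (h : ∀ i, i + 2 < 2 * k → Corner (y i) (y (i + 1)) (y (i + 2)))
    (h1 : Corner (y (2 * k - 2)) (y (2 * k - 1)) (y 0))
    (h2 : Corner (y (2 * k - 1)) (y 0) (y 1)) :
    IsZigzagCycle (fun i => y (i % (2 * k))) k := by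
  refine ⟨by omega, fun i => by simp, fun i => ?_⟩
  change Corner (y (i % (2 * k))) (y ((i + 1) % (2 * k))) (y ((i + 2) % (2 * k)))
  rw [Nat.add_mod i 1, Nat.add_mod i 2]
  have hr : i % (2 * k) < 2 * k := Nat.mod_lt _ (by omega)
  generalize i % (2 * k) = r at hr ⊢
  rw [Nat.mod_eq_of_lt (show 1 < 2 * k by omega), Nat.mod_eq_of_lt (show 2 < 2 * k by omega)]
  rcases lt_trichotomy (r + 2) (2 * k) with hlt | heq | hgt
  · rw [Nat.mod_eq_of_lt hlt, Nat.mod_eq_of_lt (show r + 1 < 2 * k by omega)]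
    exact h r hlt
  · rw [heq, Nat.mod_self, Nat.mod_eq_of_lt (show r + 1 < 2 * k by omega),
      show r = 2 * k - 2 by omega, show 2 * k - 2 + 1 = 2 * k - 1 by omega]
    exact h1
  · rw [show r + 2 = 1 + 2 * k by omega, show r + 1 = 2 * k by omega, Nat.mod_self,
      Nat.add_mod_right, Nat.mod_eq_of_lt (show 1 < 2 * k by omega),
      show r = 2 * k - 1 by omega]
    exact h2

/-- In a minimal zigzag with comparable endpoints, the initial sink is not below the final
peak. -/
theorem not_sink_le_peak (hV : SimplyConnected V) {x : ℕ → V} {n : ℕ} (hn : 2 ≤ n)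
    (h : IsZigzag x n)
    (ih : ∀ m < n, 2 ≤ m → ∀ y : ℕ → V, IsZigzag y m → ¬ y 0 ≤ y m ∧ ¬ y m ≤ y 0)
    (h0 : x 0 < x 1) (hl : x (n - 1) < x n) : ¬ x 0 ≤ x n := by
  intro hle
  have halt := isZigzag_alternates h h0 (n - 1) (by omega)
  rw [show n - 1 + 1 = n by omega] at halt
  have heven : Even (n - 1) := by
    by_contra hne
    exact hl.asymm (halt.2 hne)
  obtain ⟨j, hj⟩ := heven
  obtain rfl | hn4 : n = 3 ∨ 4 ≤ n := by omega
  · have c1 : Corner (x 0) (x 1) (x 2) := h.2 0 (by omega)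
    have c2 : Corner (x 1) (x 2) (x 3) := h.2 1 (by omega)
    have h2 := (c2.of_gt (c1.of_lt h0).1).2
    exact c1.not_le (h2 ▸ le_inf h0.le hle)
  obtain ⟨n, rfl⟩ : ∃ k, n = k + 2 := ⟨n - 2, by omega⟩
  simp only [show n + 2 - 1 = n + 1 by omega] at *
  have hshift : IsZigzag (fun i => x (i + 1)) (n + 1) := isZigzag_shift h
  have i1 := ih (n + 1) (by omega) (by omega) _ hshift
  have i2 := ih (n + 1) (by omega) (by omega) _ (isZigzag_take h (by omega))
  have i3 := ih n (by omega) (by omega) _ (isZigzag_take hshift (by omega))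
  simp only [zero_add] at i1 i3
  set s := x 1 ⊓ x (n + 2) with hs
  set w := s ⊔ x (n + 1) with hw
  have h0s : x 0 ≤ s := le_inf h0.le hle
  have hs1 : s < x 1 := inf_le_left.lt_of_ne fun e => i1.1 (e ▸ inf_le_right)
  have hwn : w ≤ x (n + 2) := sup_le inf_le_right hl.le
  have hnw : x (n + 1) < w := le_sup_right.lt_of_ne fun e =>
    i2.1 (h0s.trans (le_sup_left.trans e.ge))
  have hsw : s < w := le_sup_left.lt_of_ne fun e =>
    i3.2 ((le_sup_right.trans e.ge).trans inf_le_left)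
  let y : ℕ → V := fun i => if i = 0 then s else if i = n + 2 then w else x i
  have y0 : y 0 = s := rfl
  have yn : y (n + 2) = w := by simp [y]
  have yi : ∀ i, i ≠ 0 → i ≠ n + 2 → y i = x i := fun i a b => by simp [y, a, b]
  have hk : 2 * (j + 1) = n + 3 := by omega
  refine hV _ _ (isZigzagCycle_mod (y := y) (k := j + 1) (by omega) ?_ ?_ ?_)
  · intro i hi
    rw [hk] at hi
    have hc : Corner (x i) (x (i + 1)) (x (i + 2)) := h.2 i (by omega)
    rcases Nat.eq_zero_or_pos i with rfl | hi0
    · rw [y0, yi _ (by omega) (by omega), yi _ (by omega) (by omega)]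
      exact hc.peak_mono h0 h0s hs1
    · rcases Nat.lt_or_ge i n with hin | hin
      · rw [yi _ (by omega) (by omega), yi _ (by omega) (by omega), yi _ (by omega) (by omega)]
        exact hc
      · obtain rfl : i = n := by omega
        rw [yn, yi _ (by omega) (by omega), yi _ (by omega) (by omega)]
        exact (hc.symm.sink_mono hl hwn hnw).symm
  · rw [hk, show n + 3 - 2 = n + 1 by omega, show n + 3 - 1 = n + 2 by omega, y0, yn,
      yi _ (by omega) (by omega)]
    exact Or.inr ⟨hnw, hsw, sup_comm _ _⟩
  · rw [hk, show n + 3 - 1 = n + 2 by omega, y0, yn, yi _ (by omega) (by omega)]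
    refine Or.inl ⟨hsw, hs1, le_antisymm (le_inf hsw.le hs1.le) ?_⟩
    exact le_inf inf_le_right (inf_le_left.trans hwn)

/-- In a simply connected lattice the endpoints of a zigzag of length at least two are
incomparable. -/
theorem isZigzag_incomparable (hV : SimplyConnected V) :
    ∀ (n : ℕ), 2 ≤ n → ∀ x : ℕ → V, IsZigzag x n → ¬ x 0 ≤ x n ∧ ¬ x n ≤ x 0 := by
  intro n
  induction n using Nat.strong_induction_on with
  | _ n ih =>
  intro hn x h
  obtain rfl | hn3 : n = 2 ∨ 3 ≤ n := by omega
  · have c : Corner _ _ _ := h.2 0 (by omega)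
    exact ⟨c.not_le, c.symm.not_le⟩
  obtain ⟨n, rfl⟩ : ∃ k, n = k + 1 := ⟨n - 1, by omega⟩
  have i1 := ih n (by omega) (by omega) _ (isZigzag_shift h)
  have i2 := ih n (by omega) (by omega) _ (isZigzag_take h (by omega))
  simp only [zero_add] at i1
  rcases h.1 0 (by omega) with h0 | h0 <;> rcases h.1 n (by omega) with hl | hl <;>
    simp only [zero_add] at h0
  · exact ⟨not_sink_le_peak hV hn h ih h0 hl, fun hle => i1.2 (hle.trans h0.le)⟩
  · exact ⟨fun hle => i2.1 (hle.trans hl.le), fun hle => i1.2 (hle.trans h0.le)⟩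
  · exact ⟨fun hle => i1.1 (h0.le.trans hle), fun hle => i2.2 (hl.le.trans hle)⟩
  · refine ⟨fun hle => i1.1 (h0.le.trans hle), ?_⟩
    have := not_sink_le_peak hV hn (isZigzag_reverse h) ih (by simpa using hl)
      (by simpa using h0)
    simpa using this

end Functions

section Lists

variable {V : Type*} [Lattice V]

/-- Zigzags as lists. -/
def IsZigzagList (l : List V) : Prop :=
  (∀ a b, [a, b] <:+: l → a < b ∨ b < a) ∧ ∀ a b c, [a, b, c] <:+: l → Corner a b c

theorem IsZigzagList.of_isInfix {l l' : List V} (h : IsZigzagList l) (hl : l' <:+: l) :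
    IsZigzagList l' :=
  ⟨fun a b hi => h.1 a b (hi.trans hl), fun a b c hi => h.2 a b c (hi.trans hl)⟩

theorem IsZigzagList.reverse {l : List V} (h : IsZigzagList l) : IsZigzagList l.reverse := by
  refine ⟨fun a b hi => (h.1 b a ?_).symm, fun a b c hi => (h.2 c b a ?_).symm⟩ <;>
  · simpa using List.IsInfix.reverse hi

theorem isZigzagList_singleton (a : V) : IsZigzagList [a] := by
  constructor
  · intro b c h
    have := h.length_le
    simp at this
  · intro b c d h
    have := h.length_le
    simp at this

theorem isZigzagList_pair {a b : V} : IsZigzagList [a, b] ↔ a < b ∨ b < a := by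
  refine ⟨fun h => h.1 a b (List.infix_refl _), fun h => ⟨?_, ?_⟩⟩
  · intro c d hi
    have := hi.eq_of_length rfl
    simp only [List.cons.injEq, and_true] at this
    rw [this.1, this.2]
    exact h
  · intro c d e hi
    have := hi.length_le
    simp at this

theorem isZigzagList_cons {a b c : V} {l : List V} :
    IsZigzagList (a :: b :: c :: l) ↔ Corner a b c ∧ IsZigzagList (b :: c :: l) := by
  constructor
  · intro h
    exact ⟨h.2 a b c ⟨[], l, rfl⟩, h.of_isInfix ⟨[a], [], by simp⟩⟩
  · rintro ⟨hc, h⟩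
    constructor
    · intro d e hi
      rcases List.infix_cons_iff.1 hi with hp | hi
      · simp only [List.cons_prefix_cons, List.nil_prefix, and_true] at hp
        obtain ⟨rfl, rfl⟩ := hp
        rcases hc with hc | hc
        · exact Or.inr hc.1
        · exact Or.inl hc.1
      · exact h.1 d e hi
    · intro d e f hi
      rcases List.infix_cons_iff.1 hi with hp | hi
      · simp only [List.cons_prefix_cons, List.nil_prefix, and_true] at hp
        obtain ⟨rfl, rfl, rfl⟩ := hp
        exact hc
      · exact h.2 d e f hi

theorem IsZigzagList.append {a b : V} {l₂ : List V} (h₂ : IsZigzagList (a :: b :: l₂)) :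
    ∀ {l₁ : List V}, IsZigzagList (l₁ ++ [a, b]) → IsZigzagList (l₁ ++ a :: b :: l₂)
  | [], _ => h₂
  | [c], h => by
    obtain ⟨hc, -⟩ := isZigzagList_cons.1 h
    exact isZigzagList_cons.2 ⟨hc, h₂⟩
  | [c, d], h => by
    obtain ⟨hc, h⟩ := isZigzagList_cons.1 h
    exact isZigzagList_cons.2 ⟨hc, IsZigzagList.append h₂ (l₁ := [d]) h⟩
  | c :: d :: e :: l, h => by
    obtain ⟨hc, h⟩ := isZigzagList_cons.1 h
    exact isZigzagList_cons.2 ⟨hc, IsZigzagList.append h₂ (l₁ := d :: e :: l) h⟩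

theorem isZigzagList_dual {l : List V} :
    IsZigzagList (V := Vᵒᵈ) l ↔ IsZigzagList (V := V) l := by
  constructor
  · intro h
    exact ⟨fun a b hi => (h.1 a b hi).symm,
      fun a b c hi => (corner_dual (V := V)).1 (h.2 a b c hi)⟩
  · intro h
    exact ⟨fun a b hi => (h.1 a b hi).symm,
      fun a b c hi => (corner_dual (V := V)).2 (h.2 a b c hi)⟩

/-- The initial sink of a zigzag list may be enlarged as long as it stays below its neighbour. -/
theorem IsZigzagList.replace_sink {a a' b : V} {l : List V} (h : IsZigzagList (a :: b :: l))
    (hab : a < b) (haa' : a ≤ a') (ha'b : a' < b) : IsZigzagList (a' :: b :: l) := by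
  cases l with
  | nil => exact isZigzagList_pair.2 (Or.inl ha'b)
  | cons c l =>
    obtain ⟨hc, h⟩ := isZigzagList_cons.1 h
    exact isZigzagList_cons.2 ⟨hc.peak_mono hab haa' ha'b, h⟩

theorem isZigzag_of_list (d : V) :
    ∀ {l : List V} {n : ℕ}, IsZigzagList l → l.length = n + 1 → IsZigzag (fun i => l.getD i d) n
  | [], _, _, h => by simp at h
  | [a], n, _, h => by
    obtain rfl : n = 0 := by simpa using h.symm
    exact ⟨fun i hi => by omega, fun i hi => by omega⟩
  | [a, b], n, hz, h => by
    obtain rfl : n = 1 := by simpa using h.symm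
    refine ⟨fun i hi => ?_, fun i hi => by omega⟩
    obtain rfl : i = 0 := by omega
    exact isZigzagList_pair.1 hz
  | a :: b :: c :: l, n, hz, h => by
    obtain ⟨n, rfl⟩ : ∃ k, n = k + 1 := ⟨l.length + 1, by simpa using h.symm⟩
    obtain ⟨hc, hz'⟩ := isZigzagList_cons.1 hz
    have ih := isZigzag_of_list d (l := b :: c :: l) (n := n) hz' (by simpa using h)
    refine ⟨fun i hi => ?_, fun i hi => ?_⟩
    · cases i with
      | zero => exact hz.1 a b ⟨[], c :: l, rfl⟩
      | succ i => exact ih.1 i (by omega)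
    · cases i with
      | zero => exact hc
      | succ i => exact ih.2 i (by omega)

theorem isZigzagList_termList :
    ∀ {n : ℕ} {x : ℕ → V}, IsZigzag x n → IsZigzagList (termList x n)
  | 0, x, _ => isZigzagList_singleton _
  | 1, x, h => isZigzagList_pair.2 (h.1 0 (by omega))
  | n + 2, x, h => by
    have ih := isZigzagList_termList (isZigzag_shift h)
    cases n <;> exact isZigzagList_cons.2 ⟨h.2 0 (by omega), ih⟩

theorem IsZigzagList.incomparable (hV : SimplyConnected V) {a b : V} {l : List V} (hl : l ≠ [])
    (h : IsZigzagList (a :: (l ++ [b]))) : ¬ a ≤ b ∧ ¬ b ≤ a := by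
  have hpos := List.length_pos_iff.2 hl
  have := isZigzag_incomparable hV (l.length + 1) (by omega) _
    (isZigzag_of_list a (n := l.length + 1) h (by simp))
  simpa using this

end Lists

section Extension

variable {V : Type*} [Lattice V] {X : Set V} {a b : V}

theorem isZigzagList_push_end {e x : V} {r : List V} (hab : a < b) (hx : x < b)
    (hxa : x ⊔ a = b) (he : e < b) (hea : e ⊔ a ≠ b) (h : IsZigzagList (e :: x :: r)) :
    IsZigzagList ((e ⊔ a) :: ((e ⊔ a) ⊓ x) :: x :: r) := by
  have hle : e ⊔ a ≤ b := sup_le he.le hab.le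
  have hex : e < x := by
    refine (h.1 e x ⟨[], r, rfl⟩).resolve_right fun hxe => hea (le_antisymm hle ?_)
    exact hxa ▸ sup_le_sup_right hxe.le a
  have h1 : (e ⊔ a) ⊓ x < e ⊔ a := inf_le_left.lt_of_ne fun heq => by
    have : a ≤ x := le_sup_right.trans (inf_eq_left.1 heq)
    exact hx.ne ((sup_eq_left.2 this).symm.trans hxa)
  have h2 : (e ⊔ a) ⊓ x < x := inf_le_right.lt_of_ne fun heq => by
    refine hea (le_antisymm hle ?_)
    exact hxa ▸ sup_le (inf_eq_right.1 heq) le_sup_right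
  exact isZigzagList_cons.2
    ⟨Or.inl ⟨h1, h2, rfl⟩, h.replace_sink hex (le_inf le_sup_left hex.le) h2⟩

theorem no_bounded_zigzagList (hV : SimplyConnected V) {e e' : V} {m : List V} (hab : a < b)
    (hm : m ≠ []) (hmb : ∀ y ∈ m, y < b ∧ y ⊔ a = b) (he : e < b) (hea : e ⊔ a ≠ b)
    (he' : e' < b) (hea' : e' ⊔ a ≠ b) (h : IsZigzagList (e :: (m ++ [e']))) : False := by
  obtain ⟨x, r, rfl⟩ := List.exists_cons_of_ne_nil hm
  obtain ⟨hx, hxa⟩ := hmb x (by simp)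
  have h1 := isZigzagList_push_end hab hx hxa he hea h
  have h1' := h1.reverse
  have hr : ∀ y ∈ (x :: r).reverse, y < b ∧ y ⊔ a = b := fun y hy => hmb y (List.mem_reverse.1 hy)
  obtain ⟨x', r', hxr⟩ := List.exists_cons_of_ne_nil
    (show (x :: r).reverse ≠ [] by simp)
  have hrev : ((e ⊔ a) :: ((e ⊔ a) ⊓ x) :: x :: (r ++ [e'])).reverse
      = e' :: x' :: (r' ++ [(e ⊔ a) ⊓ x, e ⊔ a]) := by
    have : ((e ⊔ a) :: ((e ⊔ a) ⊓ x) :: x :: (r ++ [e'])).reverse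
      = e' :: ((x :: r).reverse ++ [(e ⊔ a) ⊓ x, e ⊔ a]) := by simp
    rw [this, hxr]
    rfl
  have h1'' : IsZigzagList (e' :: x' :: (r' ++ [(e ⊔ a) ⊓ x, e ⊔ a])) := hrev ▸ h1'
  obtain ⟨hx', hxa'⟩ := hr x' (by rw [hxr]; simp)
  have h2 := isZigzagList_push_end hab hx' hxa' he' hea' h1''
  set E := e ⊔ a with hE
  set E' := e' ⊔ a with hE'
  set s := E ⊓ x with hs
  have h3 : IsZigzagList (E' :: ((E' ⊓ x') :: x' :: (r' ++ [s]) ++ [E])) := by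
    simpa using h2
  have hinc := h3.incomparable hV (by simp)
  have h4 : IsZigzagList (E :: s :: ((x' :: r').reverse ++ [E' ⊓ x', E'])) := by
    have := h3.reverse
    simpa using this
  have hs_lt : s < E := by
    have c := isZigzagList_cons.1 h1
    rcases c.1 with c | c
    · exact c.1
    · exact absurd c.1 (not_lt_of_ge inf_le_left)
  have hex : e ≤ x := by
    by_contra hne
    have hxe := (h.1 e x ⟨[], r ++ [e'], rfl⟩).resolve_left fun hlt => hne hlt.le
    exact hea (le_antisymm (sup_le he.le hab.le) (hxa ▸ sup_le_sup_right hxe.le a))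
  have ht : E ⊓ E' < E := inf_le_left.lt_of_ne fun heq => hinc.2 (inf_eq_left.1 heq)
  have hc : Corner (E ⊓ E') E s := by
    refine Or.inr ⟨ht, hs_lt, le_antisymm ?_ (sup_le ht.le hs_lt.le)⟩
    refine sup_le ?_ ?_
    · exact (le_inf le_sup_left hex).trans le_sup_right
    · exact (le_inf le_sup_right le_sup_right).trans le_sup_left
  have h5 : IsZigzagList ((E ⊓ E') :: ((E :: s :: ((x' :: r').reverse ++ [E' ⊓ x'])) ++ [E'])) := by
    have := isZigzagList_cons.2 ⟨hc, h4⟩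
    simpa using this
  exact (h5.incomparable hV (by simp)).1 inf_le_right

/-- Follow a zigzag ending in `X` from an element `s` with `s ⊔ a = b`: either some zigzag
`a, b, …` reaches `X`, or the second term already lies above `b`, or the zigzag stays strictly
below `b` until some term whose join with `a` is not `b`. -/
theorem extend_or_blocked (hab : a < b) :
    ∀ (l : List V) (s : V), IsZigzagList (s :: l) → (∀ z ∈ (s :: l).getLast?, z ∈ X) →
      s < b → s ⊔ a = b →
      (∃ l' x, x ∈ X ∧ IsZigzagList (a :: b :: (l' ++ [x]))) ∨
      (∃ h ∈ l.head?, b ≤ h) ∨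
      ∃ m e r, l = m ++ e :: r ∧ (∀ y ∈ m, y < b ∧ y ⊔ a = b) ∧ e < b ∧ e ⊔ a ≠ b := by
  intro l
  induction l with
  | nil =>
    intro s _ hX hs hsa
    refine Or.inl ⟨[], s, hX s rfl, isZigzagList_cons.2 ⟨?_, isZigzagList_pair.2 (Or.inr hs)⟩⟩
    exact Or.inr ⟨hab, hs, by rw [sup_comm]; exact hsa.symm⟩
  | cons h l ih =>
    intro s hz hX hs hsa
    have hz' : IsZigzagList (h :: l) := hz.of_isInfix ⟨[s], [], by simp⟩
    have hX' : ∀ z ∈ (h :: l).getLast?, z ∈ X := by simpa [List.getLast?_cons] using hX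
    have step : h < b → h ⊔ a = b →
        (∃ l' x, x ∈ X ∧ IsZigzagList (a :: b :: (l' ++ [x]))) ∨
        ∃ m e r, h :: l = m ++ e :: r ∧ (∀ y ∈ m, y < b ∧ y ⊔ a = b) ∧ e < b ∧ e ⊔ a ≠ b := by
      intro hh hha
      rcases ih h hz' hX' hh hha with hg | ⟨g, hg, hbg⟩ | ⟨m, e, r, rfl, hm, he⟩
      · exact Or.inl hg
      · cases l with
        | nil => simp at hg
        | cons g' l =>
          obtain rfl : g' = g := by simpa using hg
          exact absurd (hs.le.trans hbg) (isZigzagList_cons.1 hz).1.not_le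
      · refine Or.inr ⟨h :: m, e, r, rfl, ?_, he⟩
        intro y hy
        rcases List.mem_cons.1 hy with rfl | hy
        · exact ⟨hh, hha⟩
        · exact hm y hy
    rcases hz.1 s h ⟨[], l, rfl⟩ with hsh | hhs
    · by_cases hbh : b ≤ h
      · exact Or.inr (Or.inl ⟨h, rfl, hbh⟩)
      by_cases hhb : h < b
      · have : h ⊔ a = b :=
          le_antisymm (sup_le hhb.le hab.le) (hsa ▸ sup_le_sup_right hsh.le a)
        exact (step hhb this).imp_right Or.inr
      · left
        have hcb : b ⊓ h < b := inf_le_left.lt_of_ne fun e => hbh (inf_eq_left.1 e)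
        have hch : b ⊓ h < h := inf_le_right.lt_of_ne fun e =>
          hbh ((inf_eq_right.1 e).eq_or_lt.elim (fun e => e.ge) fun hlt => absurd hlt hhb)
        have hsc : s ≤ b ⊓ h := le_inf hs.le hsh.le
        have h1 : IsZigzagList ((b ⊓ h) :: h :: l) := hz.replace_sink hsh hsc hch
        have h2 := isZigzagList_cons.2 ⟨(Or.inl ⟨hcb, hch, rfl⟩ : Corner b (b ⊓ h) h), h1⟩
        have hc : Corner a b (b ⊓ h) := by
          refine Or.inr ⟨hab, hcb, le_antisymm ?_ (sup_le hab.le hcb.le)⟩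
          exact hsa ▸ sup_le (hsc.trans (hsa ▸ le_sup_right)) le_sup_left
        have h3 := isZigzagList_cons.2 ⟨hc, h2⟩
        have hne : h :: l ≠ [] := by simp
        refine ⟨(b ⊓ h) :: (h :: l).dropLast, (h :: l).getLast hne,
          hX' _ (List.getLast?_eq_some_getLast hne), ?_⟩
        rw [List.cons_append, List.dropLast_append_getLast]
        exact h3
    · by_cases hha : h ⊔ a = b
      · exact (step (hhs.trans hs) hha).imp_right Or.inr
      · exact Or.inr (Or.inr ⟨[], h, l, rfl, by simp, hhs.trans hs, hha⟩)

/-- The elements lying on zigzag lists between elements of `X`. -/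
def zigzagHull (X : Set V) : Set V :=
  {u | ∃ l, IsZigzagList l ∧ (∀ z ∈ l.head?, z ∈ X) ∧ (∀ z ∈ l.getLast?, z ∈ X) ∧ u ∈ l}

theorem extend_of_lt (hV : SimplyConnected V) {u : V} (hu : u ∈ zigzagHull X)
    (hub : u < b) (hc : Corner u b a) :
    ∃ l x, x ∈ X ∧ IsZigzagList (a :: b :: (l ++ [x])) := by
  obtain ⟨hab, hsup⟩ := hc.of_lt hub
  obtain ⟨q, hq, hfst, hlst, huq⟩ := hu
  obtain ⟨l₁, l₂, rfl⟩ := List.append_of_mem huq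
  have hR : IsZigzagList (u :: l₂) := hq.of_isInfix ⟨l₁, [], by simp⟩
  have hL : IsZigzagList (u :: l₁.reverse) := by
    have : IsZigzagList (l₁ ++ [u]) := hq.of_isInfix ⟨[], l₂, by simp⟩
    simpa using this.reverse
  have hRX : ∀ z ∈ (u :: l₂).getLast?, z ∈ X := by
    simpa [List.getLast?_append, List.getLast?_cons] using hlst
  have hLX : ∀ z ∈ (u :: l₁.reverse).getLast?, z ∈ X := by
    have : (u :: l₁.reverse).getLast? = (l₁ ++ u :: l₂).head? := by
      cases l₁ <;> simp [List.getLast?_cons]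
    rw [this]
    exact hfst
  have hmid : ∀ h₁ ∈ l₁.reverse.head?, ∀ h₂ ∈ l₂.head?, Corner h₁ u h₂ := by
    intro h₁ hh₁ h₂ hh₂
    obtain ⟨r₁, hr₁⟩ : ∃ r, l₁.reverse = h₁ :: r := List.head?_eq_some_iff.1 hh₁
    obtain ⟨r₂, rfl⟩ := List.head?_eq_some_iff.1 hh₂
    have : l₁ = r₁.reverse ++ [h₁] := by
      rw [← List.reverse_reverse l₁, hr₁, List.reverse_cons]
    exact hq.2 _ _ _ ⟨r₁.reverse, r₂, by rw [this]; simp⟩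
  have blocked_head : ∀ {m : List V} {e : V} {r : List V},
      (∀ y ∈ m, y < b ∧ y ⊔ a = b) → e < b → ∃ h ∈ (m ++ e :: r).head?, h < b := by
    intro m e r hm he
    cases m with
    | nil => exact ⟨e, rfl, he⟩
    | cons y m => exact ⟨y, rfl, (hm y (by simp)).1⟩
  rcases extend_or_blocked hab _ u hL hLX hub hsup.symm with
    hg | ⟨h₁, hh₁, hb₁⟩ | ⟨m₁, e₁, r₁, hl₁, hm₁, he₁, hea₁⟩
  · exact hg
  · rcases extend_or_blocked hab _ u hR hRX hub hsup.symm with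
      hg | ⟨h₂, hh₂, hb₂⟩ | ⟨m₂, e₂, r₂, hl₂, hm₂, he₂, hea₂⟩
    · exact hg
    · have := ((hmid _ hh₁ _ hh₂).of_gt (hub.trans_le hb₁)).2
      exact absurd (this ▸ le_inf hb₁ hb₂) (not_le_of_gt hub)
    · obtain ⟨h₂, hh₂, hb₂⟩ := blocked_head (r := r₂) hm₂ he₂
      rw [← hl₂] at hh₂
      exact absurd (hb₂.le.trans hb₁) (hmid _ hh₁ _ hh₂).symm.not_le
  · rcases extend_or_blocked hab _ u hR hRX hub hsup.symm with
      hg | ⟨h₂, hh₂, hb₂⟩ | ⟨m₂, e₂, r₂, hl₂, hm₂, he₂, hea₂⟩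
    · exact hg
    · obtain ⟨h₁, hh₁, hb₁⟩ := blocked_head (r := r₁) hm₁ he₁
      rw [← hl₁] at hh₁
      exact absurd (hb₁.le.trans hb₂) (hmid _ hh₁ _ hh₂).not_le
    · exfalso
      have hl₁' : l₁ = r₁.reverse ++ (e₁ :: m₁.reverse) := by
        rw [← List.reverse_reverse l₁, hl₁]
        simp
      refine no_bounded_zigzagList hV (m := m₁.reverse ++ u :: m₂) hab (by simp) ?_ he₁ hea₁
        he₂ hea₂ (hq.of_isInfix ⟨r₁.reverse, r₂, ?_⟩)
      · intro y hy
        rcases List.mem_append.1 hy with hy | hy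
        · exact hm₁ y (List.mem_reverse.1 hy)
        · rcases List.mem_cons.1 hy with rfl | hy
          · exact ⟨hub, hsup.symm⟩
          · exact hm₂ y hy
      · rw [hl₁', hl₂]
        simp

theorem simplyConnected_dual (hV : SimplyConnected V) : SimplyConnected Vᵒᵈ :=
  fun x n ⟨h0, hp, hc⟩ => hV x n ⟨h0, hp, fun i => corner_dual.1 (hc i)⟩

theorem extend_corner (hV : SimplyConnected V) {u : V} (hu : u ∈ zigzagHull X)
    (hc : Corner u b a) : ∃ l x, x ∈ X ∧ IsZigzagList (a :: b :: (l ++ [x])) := by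
  by_cases hub : u < b
  · exact extend_of_lt hV hu hub hc
  · have hbu : b < u := by
      rcases hc with hc | hc
      · exact hc.1
      · exact absurd hc.1 hub
    obtain ⟨l, hl, h⟩ := hu
    obtain ⟨l', x, hx, h'⟩ := extend_of_lt (V := Vᵒᵈ) (X := X) (a := a) (b := b) (u := u)
      (simplyConnected_dual hV) ⟨l, isZigzagList_dual.2 hl, h⟩ hbu (corner_dual.2 hc)
    exact ⟨l', x, hx, isZigzagList_dual.1 h'⟩

theorem extend_list (hV : SimplyConnected V) {u : V} (hu : u ∈ zigzagHull X) {m : List V}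
    (hm : 2 ≤ m.length) (h : IsZigzagList (u :: m)) :
    ∃ x l, x ∈ X ∧ IsZigzagList (x :: (l ++ m)) := by
  obtain ⟨b, a, r, rfl⟩ : ∃ b a r, m = b :: a :: r := by
    match m, hm with
    | b :: a :: r, _ => exact ⟨b, a, r, rfl⟩
  obtain ⟨hc, hr⟩ := isZigzagList_cons.1 h
  obtain ⟨l, x, hx, hl⟩ := extend_corner hV hu hc
  refine ⟨x, l.reverse, hx, ?_⟩
  have := IsZigzagList.append hr (l₁ := x :: l.reverse) (by simpa using hl.reverse)
  simpa using this

theorem mem_zigzagHull_of_zigzagList (hV : SimplyConnected V) {u v : V}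
    (hu : u ∈ zigzagHull X) (hv : v ∈ zigzagHull X) {m : List V} (hm : m ≠ [])
    (h : IsZigzagList (u :: (m ++ [v]))) : ∀ y ∈ m, y ∈ zigzagHull X := by
  have hpos := List.length_pos_iff.2 hm
  obtain ⟨x, l, hx, hl⟩ := extend_list hV hu (by simp; omega) h
  have hrev : IsZigzagList (v :: (m.reverse ++ (l.reverse ++ [x]))) := by
    simpa using hl.reverse
  obtain ⟨x', l', hx', hl'⟩ := extend_list hV hv (by simp; omega) hrev
  intro y hy
  refine ⟨_, hl', by simpa using hx', ?_, by simp [hy]⟩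
  have : (x' :: (l' ++ (m.reverse ++ (l.reverse ++ [x])))).getLast? = some x := by
    rw [show x' :: (l' ++ (m.reverse ++ (l.reverse ++ [x])))
      = (x' :: (l' ++ (m.reverse ++ l.reverse))) ++ [x] by simp, List.getLast?_concat]
  rw [this]
  simpa using hx

theorem mem_zigzagHull_iff {y : V} : y ∈ zigzagHull X ↔
    ∃ (p : ℕ → V) (n : ℕ), IsZigzag p n ∧ p 0 ∈ X ∧ p n ∈ X ∧ ∃ i ≤ n, p i = y := by
  constructor
  · rintro ⟨l, hl, h0, h1, hy⟩
    have hpos := List.length_pos_of_mem hy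
    obtain ⟨i, hi, rfl⟩ := List.getElem_of_mem hy
    refine ⟨fun j => l.getD j l[i], l.length - 1, isZigzag_of_list (n := l.length - 1) _ hl (by omega), ?_, ?_,
      i, by omega, ?_⟩
    · refine h0 _ ?_
      simp [List.head?_eq_getElem?, List.getD_eq_getElem?_getD, hpos]
    · refine h1 _ ?_
      simp [List.getLast?_eq_getElem?, List.getD_eq_getElem?_getD, hpos]
    · simp [List.getD_eq_getElem?_getD, hi]
  · rintro ⟨p, n, hp, h0, h1, hy⟩
    refine ⟨termList p n, isZigzagList_termList hp, ?_, ?_, mem_termList.2 hy⟩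
    · simpa [head?_termList] using h0
    · simpa [getLast?_termList] using h1

theorem isZigzag_mem_zigzagHull (hV : SimplyConnected V) {p : ℕ → V} {n : ℕ} (h : IsZigzag p n)
    (h0 : p 0 ∈ zigzagHull X) (hn : p n ∈ zigzagHull X) :
    ∀ i ≤ n, p i ∈ zigzagHull X := by
  intro i hi
  rcases Nat.eq_zero_or_pos i with rfl | hi0
  · exact h0
  rcases hi.eq_or_lt with rfl | hin
  · exact hn
  obtain ⟨n, rfl⟩ : ∃ k, n = k + 2 := ⟨n - 2, by omega⟩
  set r := termList (fun i => p (i + 1)) n with hr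
  have happ : ∀ (n : ℕ) (x : ℕ → V), termList x (n + 1) = termList x n ++ [x (n + 1)] := by
    intro n
    induction n with
    | zero => intro x; rfl
    | succ n ih => intro x; rw [termList, ih]; rfl
  have hlist : termList p (n + 2) = p 0 :: (r ++ [p (n + 2)]) := by
    rw [termList, happ]
  refine mem_zigzagHull_of_zigzagList hV h0 hn (m := r) ?_ (hlist ▸ isZigzagList_termList h) _
    (mem_termList.2 ⟨i - 1, by omega, by simp only [Nat.sub_add_cancel hi0]⟩)
  cases n <;> simp [hr, termList]

end Extension

/-- A zigzag of length at least two has no extremal endpoint. -/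
theorem isZigzag_ne_bot_top {M : Type*} [Lattice M] [BoundedOrder M] {x : ℕ → M} {n : ℕ}
    (h : IsZigzag x n) (hn : 2 ≤ n) : x 0 ≠ ⊥ ∧ x 0 ≠ ⊤ := by
  have hc : Corner (x 0) (x 1) (x 2) := h.2 0 hn
  exact ⟨fun e => hc.not_le (e ▸ bot_le), fun e => hc.symm.not_le (e ▸ le_top)⟩

theorem zClosed_zigzagHull {M : Type*} [Lattice M] [BoundedOrder M] (hM : SimplyConnected M)
    (X : Set M) : ZClosed ({⊥, ⊤} ∪ zigzagHull X) := by
  refine ⟨by simp, by simp, fun x n h h0 hn i hi => ?_⟩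
  rcases Nat.lt_or_ge n 2 with hlt | hge
  · obtain rfl | rfl : i = 0 ∨ i = n := by omega
    · exact h0
    · exact hn
  · have e0 := isZigzag_ne_bot_top h hge
    have en := isZigzag_ne_bot_top (isZigzag_reverse h) hge
    simp only [Nat.sub_zero] at en
    have h0' : x 0 ∈ zigzagHull X := h0.resolve_left (by simpa using e0)
    have hn' : x n ∈ zigzagHull X := hn.resolve_left (by simpa using en)
    exact Or.inr (isZigzag_mem_zigzagHull hM h h0' hn' i hi)

end ZigzagClosure

/-- (Corollary 4.9) The closure of a set `X` consists of `⊥`, `⊤` and all elements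
lying on zigzags between elements of `X`. -/
theorem zcl_eq_zigzags {N : ℕ} {M : Type*}
    [Lattice M] [BoundedOrder M] (P : FreePseudospace N M) (X : Set M) :
    zcl X = {⊥, ⊤} ∪
      {y : M | ∃ (p : ℕ → M) (n : ℕ),
        IsZigzag p n ∧ p 0 ∈ X ∧ p n ∈ X ∧ ∃ i ≤ n, p i = y} := by
  have hset : {y : M | ∃ (p : ℕ → M) (n : ℕ),
      IsZigzag p n ∧ p 0 ∈ X ∧ p n ∈ X ∧ ∃ i ≤ n, p i = y} = ZigzagClosure.zigzagHull X :=
    Set.ext fun _ => ZigzagClosure.mem_zigzagHull_iff.symm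
  apply Set.Subset.antisymm
  · rw [hset]
    refine Set.sInter_subset_of_mem ⟨ZigzagClosure.zClosed_zigzagHull P.simplyConnected X, ?_⟩
    intro x hx
    exact Or.inr ⟨[x], ZigzagClosure.isZigzagList_singleton x, by simpa using hx,
      by simpa using hx, by simp⟩
  · rintro y (hy | ⟨p, n, hp, h0, hn, i, hi, rfl⟩) A ⟨hA, hXA⟩
    · rcases hy with rfl | rfl
      · exact hA.1
      · exact hA.2.1
    · exact hA.2.2 p n hp (hXA h0) (hXA hn) i hi
end
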